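/- Let G be a finite group and λ : G → circle a group homomorphism. Let ρ be the left regular representation of G on ℂ[G], and define the operator v on ℂ[G] by v e_h = λ(h)⁻¹·e_h for all h ∈ G. Then v is unitary and ρ(g) v ρ(g)⁻¹ = λ(g)·v for all g ∈ G. In particular, the inner automorphism Ad_v of End(ℂ[G]) commutes with Ad_{ρ(g)} for every g ∈ G, and its charge equals the prescribed homomorphism λ. -/

import Mathlib

open EuclideanSpace in
/-- Linear maps on `EuclideanSpace 𝕜 ι` that agree on the standard basis are equal. -/
theorem EuclideanSpace.linearMap_ext_single {𝕜 ι E : Type*} [RCLike 𝕜] [Fintype ι]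
    [DecidableEq ι] [AddCommMonoid E] [Module 𝕜 E] {S T : EuclideanSpace 𝕜 ι →ₗ[𝕜] E}
    (h : ∀ i, S (single i 1) = T (single i 1)) : S = T :=
  (basisFun ι 𝕜).toBasis.ext fun i => by simpa using h i

open EuclideanSpace in
/-- The adjoint of a diagonal operator is diagonal with conjugate entries. -/
theorem EuclideanSpace.star_apply_single_of_diagonal {𝕜 ι : Type*} [RCLike 𝕜] [Fintype ι]
    [DecidableEq ι] {T : EuclideanSpace 𝕜 ι →ₗ[𝕜] EuclideanSpace 𝕜 ι} {d : ι → 𝕜}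
    (h : ∀ i, T (single i 1) = d i • single i 1) (i : ι) :
    star T (single i 1) = star (d i) • single i 1 := by
  ext j
  have key : inner 𝕜 (single j (1 : 𝕜)) (star T (single i 1)) =
      inner 𝕜 (T (single j 1)) (single i (1 : 𝕜)) := by
    rw [LinearMap.star_eq_adjoint, LinearMap.adjoint_inner_right]
  rw [h, inner_smul_left, inner_single_left, inner_single_left] at key
  rcases eq_or_ne j i with rfl | hji
  · simpa using key
  · simpa [hji] using key

/-- Let `λ : G → circle` be a group homomorphism, `ρ` the left regular
representation of `G` on `ℂ[G] = EuclideanSpace ℂ G` (so `ρ g e_h = e_{g h}`), and `v` the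
operator with `v e_h = (λ h)⁻¹ • e_h`. Then `v` is unitary and
`ρ g * v * ρ g⁻¹ = λ g • v` for all `g`; in particular `Ad_v` commutes with every
`Ad_{ρ g}` and the charge of `v` is `λ`. -/
theorem stmt7 {G : Type*} [Group G] [Fintype G] [DecidableEq G]
    (lam : G →* Circle)
    (ρ : G → (EuclideanSpace ℂ G →ₗ[ℂ] EuclideanSpace ℂ G))
    (hρ : ∀ g h : G,
      ρ g (EuclideanSpace.single h (1 : ℂ)) = EuclideanSpace.single (g * h) (1 : ℂ))
    (v : EuclideanSpace ℂ G →ₗ[ℂ] EuclideanSpace ℂ G)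
    (hv : ∀ h : G,
      v (EuclideanSpace.single h (1 : ℂ))
        = ((lam h)⁻¹ : ℂ) • EuclideanSpace.single h (1 : ℂ)) :
    v ∈ unitary (EuclideanSpace ℂ G →ₗ[ℂ] EuclideanSpace ℂ G) ∧
    (∀ g : G, ρ g * v * ρ g⁻¹ = (lam g : ℂ) • v) ∧
    (∀ (g : G) (x : EuclideanSpace ℂ G →ₗ[ℂ] EuclideanSpace ℂ G),
      ρ g * (v * x * star v) * ρ g⁻¹ = v * (ρ g * x * ρ g⁻¹) * star v) := by
  have hne (g : G) : (lam g : ℂ) ≠ 0 := Circle.coe_ne_zero _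
  have hstar (h : G) : star v (EuclideanSpace.single h (1 : ℂ))
      = (lam h : ℂ) • EuclideanSpace.single h (1 : ℂ) := by
    rw [EuclideanSpace.star_apply_single_of_diagonal hv, ← Circle.coe_inv,
      ← starRingEnd_apply, ← Circle.coe_inv_eq_conj, inv_inv]
  have hcomm (g : G) : ρ g * v = (lam g : ℂ) • (v * ρ g) := by
    refine EuclideanSpace.linearMap_ext_single fun h => ?_
    simp [hρ, hv, smul_smul]
    field_simp [hne]
  have hcomm_star (g : G) : star v * ρ g = (lam g : ℂ) • (ρ g * star v) := by
    refine EuclideanSpace.linearMap_ext_single fun h => ?_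
    simp [hρ, hstar, smul_smul]
  have hinv (g : G) : ρ g * ρ g⁻¹ = 1 :=
    EuclideanSpace.linearMap_ext_single fun h => by simp [hρ]
  refine ⟨Unitary.mem_iff.2 ⟨?_, ?_⟩, fun g => ?_, fun g x => ?_⟩
  · exact EuclideanSpace.linearMap_ext_single fun h => by simp [hv, hstar, smul_smul, hne]
  · exact EuclideanSpace.linearMap_ext_single fun h => by simp [hv, hstar, smul_smul, hne]
  · rw [hcomm, smul_mul_assoc, mul_assoc, hinv, mul_one]
  · calc ρ g * (v * x * star v) * ρ g⁻¹ = (ρ g * v) * x * (star v * ρ g⁻¹) := by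
          simp only [mul_assoc]
      _ = v * (ρ g * x * ρ g⁻¹) * star v := by
          rw [hcomm, hcomm_star]
          simp [smul_smul, mul_assoc, hne]
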